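/- arXiv:1604.00634 — 6 statements merged into one kernel-verified Lean document; each statement's English description precedes it below -/
import Mathlib

section
/- For every real number λ > 0 and every natural number n, there exists a unique real number x in the open interval (nπ, nπ + π/2) such that x·tan(x) = λ. Moreover, every x > 0 with cos(x) ≠ 0 and x·tan(x) = λ lies in (nπ, nπ + π/2) for some natural number n. -/
theorem strictMonoOn_add_mul_tan {c : ℝ} (hc : 0 ≤ c) :
    StrictMonoOn (fun y : ℝ => (y + c) * Real.tan y) (Set.Ioo 0 (Real.pi / 2)) := by
  intro a ha b hb hab
  exact mul_lt_mul'' (by linarith)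
    (Real.tan_lt_tan_of_nonneg_of_lt_pi_div_two ha.1.le hb.2 hab) (by linarith [ha.1])
    (Real.tan_pos_of_pos_of_lt_pi_div_two ha.1 ha.2).le

theorem exists_add_mul_tan_eq {c lam : ℝ} (hc : 0 ≤ c) (hlam : 0 < lam) :
    ∃ y ∈ Set.Ioo 0 (Real.pi / 2), (y + c) * Real.tan y = lam := by
  have hpi := Real.pi_pos
  have hcont : ContinuousOn (fun y : ℝ => (y + c) * Real.sin y - lam * Real.cos y)
      (Set.Icc 0 (Real.pi / 2)) := by fun_prop
  have hzero : (0 : ℝ) ∈ Set.Ioo ((0 + c) * Real.sin 0 - lam * Real.cos 0)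
      ((Real.pi / 2 + c) * Real.sin (Real.pi / 2) - lam * Real.cos (Real.pi / 2)) := by
    constructor
    · simpa using hlam
    · simp only [Real.sin_pi_div_two, Real.cos_pi_div_two]
      linarith
  obtain ⟨y, hy, h⟩ := intermediate_value_Ioo (by linarith) hcont hzero
  refine ⟨y, hy, ?_⟩
  have hcos : 0 < Real.cos y := Real.cos_pos_of_mem_Ioo ⟨by linarith [hy.1], hy.2⟩
  rw [Real.tan_eq_sin_div_cos, ← mul_div_assoc, div_eq_iff hcos.ne']
  exact sub_eq_zero.mp h

theorem exists_mem_Ioo_of_tan_pos {x : ℝ} (hx : 0 ≤ x) (htan : 0 < Real.tan x) :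
    ∃ n : ℕ, x ∈ Set.Ioo ((n : ℝ) * Real.pi) ((n : ℝ) * Real.pi + Real.pi / 2) := by
  have hpi := Real.pi_pos
  set n := ⌊x / Real.pi⌋₊
  have hle : (n : ℝ) * Real.pi ≤ x :=
    (le_div_iff₀ hpi).mp (Nat.floor_le (div_nonneg hx hpi.le))
  have hlt : x < ((n : ℝ) + 1) * Real.pi := (div_lt_iff₀ hpi).mp (Nat.lt_floor_add_one _)
  refine ⟨n, ?_, ?_⟩
  · refine hle.lt_of_ne fun h => htan.ne' ?_
    rw [← h, Real.tan_nat_mul_pi]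
  · by_contra! h
    have hneg : Real.tan (x - (n + 1 : ℕ) * Real.pi) ≤ 0 := by
      apply Real.tan_nonpos_of_nonpos_of_neg_pi_div_two_le <;> push_cast <;> linarith
    rw [Real.tan_sub_nat_mul_pi] at hneg
    exact hneg.not_gt htan


/-- For every real `λ > 0` and every natural number `n`, there is a unique real `x`
in the open interval `(nπ, nπ + π/2)` with `x · tan x = λ`; moreover every `x > 0`
with `cos x ≠ 0` and `x · tan x = λ` lies in such an interval for some `n`. -/
theorem stmt_0 (lam : ℝ) (hlam : 0 < lam) :
    (∀ n : ℕ, ∃! x : ℝ,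
      x ∈ Set.Ioo ((n : ℝ) * Real.pi) ((n : ℝ) * Real.pi + Real.pi / 2) ∧
      x * Real.tan x = lam) ∧
    (∀ x : ℝ, 0 < x → Real.cos x ≠ 0 → x * Real.tan x = lam →
      ∃ n : ℕ, x ∈ Set.Ioo ((n : ℝ) * Real.pi) ((n : ℝ) * Real.pi + Real.pi / 2)) := by
  refine ⟨fun n => ?_, fun x hx _ h => ?_⟩
  · have hc : 0 ≤ (n : ℝ) * Real.pi := by positivity
    obtain ⟨y, hy, h⟩ := exists_add_mul_tan_eq hc hlam
    refine ⟨y + n * Real.pi, ⟨⟨by linarith [hy.1], by linarith [hy.2]⟩, ?_⟩, ?_⟩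
    · rwa [Real.tan_add_nat_mul_pi]
    · rintro z ⟨hz, hz'⟩
      have hzy : z - n * Real.pi = y := by
        refine (strictMonoOn_add_mul_tan hc).injOn
          ⟨by linarith [hz.1], by linarith [hz.2]⟩ hy ?_
        simp only [Real.tan_sub_nat_mul_pi, sub_add_cancel, hz', h]
      linarith
  · exact exists_mem_Ioo_of_tan_pos hx.le (pos_of_mul_pos_right (h ▸ hlam) hx.le)
end

section
/- Let λ > 0 and let x₀(λ) denote the unique solution of x·tan(x) = λ in the open interval (0, π/2). Then every x > 0 with cos(x) ≠ 0 and x·tan(x) = λ satisfies x ≥ x₀(λ); in fact, every such solution other than x₀(λ) satisfies x > π. -/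
theorem strictMonoOn_mul_tan :
    StrictMonoOn (fun x : ℝ => x * Real.tan x) (Set.Ioo 0 (Real.pi / 2)) := by
  intro x hx y hy hxy
  exact mul_lt_mul'' hxy
    (Real.tan_lt_tan_of_nonneg_of_lt_pi_div_two hx.1.le hy.2 hxy)
    hx.1.le (Real.tan_pos_of_pos_of_lt_pi_div_two hx.1 hx.2).le

/-- Let `λ > 0` and let `x₀` be the unique solution of `x · tan x = λ` in `(0, π/2)`.
Then every `x > 0` with `cos x ≠ 0` and `x · tan x = λ` satisfies `x₀ ≤ x`, and every
such solution other than `x₀` satisfies `x > π`. -/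
theorem stmt_1 (lam x₀ : ℝ) (hlam : 0 < lam)
    (hx₀mem : x₀ ∈ Set.Ioo (0 : ℝ) (Real.pi / 2))
    (hx₀eq : x₀ * Real.tan x₀ = lam) :
    ∀ x : ℝ, 0 < x → Real.cos x ≠ 0 → x * Real.tan x = lam →
      x₀ ≤ x ∧ (x ≠ x₀ → Real.pi < x) := by
  intro x hx _ hxeq
  obtain ⟨h0, h0'⟩ := hx₀mem
  have htan : 0 < Real.tan x := pos_of_mul_pos_right (hxeq ▸ hlam) hx.le
  rcases lt_or_ge Real.pi x with hpi | hpi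
  · exact ⟨by linarith [Real.pi_pos], fun _ => hpi⟩
  have hlt : x < Real.pi / 2 := by
    by_contra! h
    have hnonpos := Real.tan_nonpos_of_nonpos_of_neg_pi_div_two_le
      (x := x - Real.pi) (by linarith) (by linarith)
    rw [Real.tan_sub_pi] at hnonpos
    linarith
  have heq : x = x₀ :=
    strictMonoOn_mul_tan.injOn ⟨hx, hlt⟩ ⟨h0, h0'⟩ (hxeq.trans hx₀eq.symm)
  exact ⟨heq.ge, fun hne => absurd heq hne⟩
end

section
/- Let Φ : ℝ → ℝ be continuously differentiable on [0,1] with Φ(0) = 0. Then ∫₀¹ (1 − ξ²)·(Φ'(ξ))² dξ ≥ 2·∫₀¹ Φ(ξ)² dξ. -/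
/-- The product of a function vanishing at `0` with its difference quotient at `0` extends
continuously by `0`. -/
theorem continuousWithinAt_sq_div_zero {f : ℝ → ℝ} {s : Set ℝ} {f' : ℝ}
    (hf : HasDerivWithinAt f f' s 0) (h0 : f 0 = 0) :
    ContinuousWithinAt (fun x => f x ^ 2 / x) s 0 := by
  rw [← continuousWithinAt_sdiff_self]
  have hslope := hasDerivWithinAt_iff_tendsto_slope.mp hf
  have hcont : Filter.Tendsto f (nhdsWithin 0 (s \ {0})) (nhds 0) := by
    have h := (hf.continuousWithinAt.mono (Set.sdiff_subset (t := {0}))).tendsto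
    rwa [h0] at h
  have h := hslope.mul hcont
  rw [mul_zero] at h
  simp only [ContinuousWithinAt, div_zero]
  refine h.congr fun x => ?_
  rw [slope_def_field, h0]
  ring

/-- Poincaré-type inequality: for `Φ` continuously differentiable on `[0,1]` with `Φ(0) = 0`,
`∫₀¹ (1 − ξ²)·(Φ'(ξ))² dξ ≥ 2·∫₀¹ Φ(ξ)² dξ`. -/
theorem stmt_9 (Φ : ℝ → ℝ) (hΦ : ContDiffOn ℝ 1 Φ (Set.Icc 0 1)) (hΦ0 : Φ 0 = 0) :
    (∫ ξ in (0:ℝ)..1, (1 - ξ ^ 2) * (derivWithin Φ (Set.Icc (0:ℝ) 1) ξ) ^ 2) ≥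
      2 * ∫ ξ in (0:ℝ)..1, (Φ ξ) ^ 2 := by
  set Φ' := derivWithin Φ (Set.Icc (0:ℝ) 1)
  have hderiv : ∀ x ∈ Set.Icc (0:ℝ) 1, HasDerivWithinAt Φ (Φ' x) (Set.Icc 0 1) x := fun x hx =>
    (hΦ.differentiableOn one_ne_zero x hx).hasDerivWithinAt
  have hΦ'_cont : ContinuousOn Φ' (Set.Icc 0 1) :=
    hΦ.continuousOn_derivWithin (uniqueDiffOn_Icc zero_lt_one) le_rfl
  have hΦ_cont : ContinuousOn Φ (Set.Icc 0 1) := hΦ.continuousOn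
  have hleft : ContinuousOn (fun x => (1 - x ^ 2) * Φ' x ^ 2) (Set.Icc 0 1) := by fun_prop
  have hright : ContinuousOn (fun x => 2 * Φ x ^ 2) (Set.Icc 0 1) := by fun_prop
  have hF_cont : ContinuousOn (fun x => (1 - x ^ 2) * (Φ x ^ 2 / x)) (Set.Icc 0 1) := by
    refine ContinuousOn.mul (by fun_prop) fun x hx => ?_
    rcases eq_or_ne x 0 with rfl | hx0
    · exact continuousWithinAt_sq_div_zero (hderiv 0 hx) hΦ0
    · exact ((hΦ_cont x hx).pow 2).div continuousWithinAt_id hx0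
  -- `(1 - x²) Φ'² - 2 Φ²` is the derivative of `(1 - x²) Φ² / x` plus `(1 - x²) (Φ' - Φ / x)²`.
  have key := intervalIntegral.sub_le_integral_of_hasDeriv_right_of_le zero_le_one hF_cont
    (g' := fun x => -(2 * x) * (Φ x ^ 2 / x) +
      (1 - x ^ 2) * ((2 * Φ x * Φ' x * x - Φ x ^ 2) / x ^ 2))
    (φ := fun x => (1 - x ^ 2) * Φ' x ^ 2 - 2 * Φ x ^ 2)
    (fun x hx => by
      have h := (hderiv x ⟨hx.1.le, hx.2.le⟩).hasDerivAt (Icc_mem_nhds hx.1 hx.2)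
      have h1 : HasDerivAt (fun y : ℝ => 1 - y ^ 2) (-(2 * x)) x := by
        simpa using (hasDerivAt_pow 2 x).const_sub 1
      have h2 := (h.pow 2).div (hasDerivAt_id x) hx.1.ne'
      refine ((h1.mul h2).congr_deriv ?_).hasDerivWithinAt
      simp)
    (hleft.sub hright).integrableOn_Icc
    (fun x hx => by
      have hx0 : x ≠ 0 := hx.1.ne'
      have hsq : 0 ≤ (1 - x ^ 2) * (Φ' x - Φ x / x) ^ 2 :=
        mul_nonneg (by nlinarith [hx.1, hx.2]) (sq_nonneg _)
      have heq : (1 - x ^ 2) * Φ' x ^ 2 - 2 * Φ x ^ 2 - (-(2 * x) * (Φ x ^ 2 / x) +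
          (1 - x ^ 2) * ((2 * Φ x * Φ' x * x - Φ x ^ 2) / x ^ 2)) =
          (1 - x ^ 2) * (Φ' x - Φ x / x) ^ 2 := by
        field_simp
        ring
      linarith)
  rw [intervalIntegral.integral_sub
    (hleft.intervalIntegrable_of_Icc zero_le_one) (hright.intervalIntegrable_of_Icc zero_le_one),
    intervalIntegral.integral_const_mul] at key
  norm_num at key
  exact key
end

section
/- Let Θ̂ > 0 and define Θ(ξ) = (3/2)·Θ̂·(1 − ξ²) and Φ(ξ) = √3·ξ. Then: (i) ∫₀¹ Θ(ξ) dξ = Θ̂; (ii) ∫₀¹ Φ(ξ)² dξ = 1; (iii) Φ(0) = 0; (iv) d/dξ( Θ(ξ)·Φ'(ξ) ) + 3Θ̂·Φ(ξ) = 0 for all real ξ; and (v) ∫₀¹ Θ(ξ)·(Φ'(ξ))² dξ = 3Θ̂. -/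
/-- The optimal variable diffusion parameter `Θ(ξ) = (3/2)·Θ̂·(1 − ξ²)` and eigenfunction
`Φ(ξ) = √3·ξ`: average value, normalization, boundary value, Sturm–Liouville equation with
eigenvalue `3Θ̂`, and Rayleigh-quotient value `3Θ̂`. -/
theorem stmt_10 (Θhat : ℝ) (hΘ : 0 < Θhat) (Θ Φ : ℝ → ℝ)
    (hΘdef : Θ = fun ξ : ℝ => (3 / 2) * Θhat * (1 - ξ ^ 2))
    (hΦdef : Φ = fun ξ : ℝ => Real.sqrt 3 * ξ) :
    (∫ ξ in (0:ℝ)..1, Θ ξ) = Θhat ∧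
    (∫ ξ in (0:ℝ)..1, (Φ ξ) ^ 2) = 1 ∧
    Φ 0 = 0 ∧
    (∀ ξ : ℝ, deriv (fun x => Θ x * deriv Φ x) ξ + 3 * Θhat * Φ ξ = 0) ∧
    (∫ ξ in (0:ℝ)..1, Θ ξ * (deriv Φ ξ) ^ 2) = 3 * Θhat := by
  subst hΘdef hΦdef
  have h3 : Real.sqrt 3 ^ 2 = 3 := Real.sq_sqrt (by norm_num)
  have hderiv (x : ℝ) : deriv (fun ξ : ℝ => Real.sqrt 3 * ξ) x = Real.sqrt 3 := by
    simp
  have hint : (∫ ξ in (0:ℝ)..1, (3 / 2) * Θhat * (1 - ξ ^ 2)) = Θhat := by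
    rw [intervalIntegral.integral_const_mul,
      intervalIntegral.integral_sub (by simp) (by simp), integral_pow]
    norm_num
    ring
  refine ⟨hint, ?_, by simp, fun ξ => ?_, ?_⟩
  · simp only [mul_pow, h3]
    rw [intervalIntegral.integral_const_mul, integral_pow]
    norm_num
  · simp only [hderiv]
    have h := ((((hasDerivAt_pow 2 ξ).const_sub 1).const_mul (3 / 2 * Θhat)).mul_const
      (Real.sqrt 3)).deriv
    rw [h]
    push_cast
    ring
  · simp only [hderiv, h3]
    rw [intervalIntegral.integral_mul_const, hint, mul_comm]
end

section
/- Let Θ̂ > 0 and let p be a natural number with p ≥ 1. With μ_{2k} = (2kπ)²·Θ̂/4 for k ≥ 1 and μ_{2k+1} = ((2k+1)π)²·Θ̂/4 for k ≥ 0, the sum of reciprocals of the decay exponents counted with multiplicity satisfies ∑_{k=1}^{∞} 1/μ_{2k} + (p−1)·∑_{k=0}^{∞} 1/μ_{2k+1} = (3p − 2)/(6Θ̂). Consequently the robustness H = √( (1/2)·(that sum) ) equals (1/2)·√((3p − 2)/(3Θ̂)). -/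
theorem hasSum_one_div_succ_sq :
    HasSum (fun k : ℕ => 1 / ((k : ℝ) + 1) ^ 2) (Real.pi ^ 2 / 6) := by
  simpa using (hasSum_nat_add_iff' 1).mpr hasSum_zeta_two

theorem hasSum_one_div_odd_sq :
    HasSum (fun k : ℕ => 1 / (2 * (k : ℝ) + 1) ^ 2) (Real.pi ^ 2 / 8) := by
  have heven : HasSum (fun k : ℕ => (1 : ℝ) / ((2 * k : ℕ) : ℝ) ^ 2) (Real.pi ^ 2 / 24) := by
    rw [show Real.pi ^ 2 / 24 = 1 / 4 * (Real.pi ^ 2 / 6) by ring]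
    convert! hasSum_zeta_two.mul_left (1 / 4) using 2 with k
    push_cast
    rw [mul_pow, ← one_div_mul_one_div]
    norm_num
  have hodd : Summable fun k : ℕ => (1 : ℝ) / ((2 * k + 1 : ℕ) : ℝ) ^ 2 :=
    hasSum_zeta_two.summable.comp_injective (i := fun k : ℕ => 2 * k + 1)
      fun a b h => by simpa using h
  have hsum := (HasSum.even_add_odd (f := fun n : ℕ => (1 : ℝ) / (n : ℝ) ^ 2)
    heven hodd.hasSum).unique hasSum_zeta_two
  have hval : Real.pi ^ 2 / 8 = ∑' k : ℕ, (1 : ℝ) / ((2 * k + 1 : ℕ) : ℝ) ^ 2 := by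
    linarith
  rw [hval]
  convert! hodd.hasSum using 2 with k
  push_cast
  rfl

theorem hasSum_inv_even_decay_exponent {Θ : ℝ} (hΘ : 0 < Θ) :
    HasSum (fun k : ℕ => 1 / ((2 * ((k : ℝ) + 1) * Real.pi) ^ 2 * Θ / 4)) (1 / (6 * Θ)) := by
  rw [show 1 / (6 * Θ) = 1 / (Real.pi ^ 2 * Θ) * (Real.pi ^ 2 / 6) by field_simp]
  convert! hasSum_one_div_succ_sq.mul_left _ using 2 with k
  field_simp
  norm_num

theorem hasSum_inv_odd_decay_exponent {Θ : ℝ} (hΘ : 0 < Θ) :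
    HasSum (fun k : ℕ => 1 / (((2 * (k : ℝ) + 1) * Real.pi) ^ 2 * Θ / 4)) (1 / (2 * Θ)) := by
  rw [show 1 / (2 * Θ) = 4 / (Real.pi ^ 2 * Θ) * (Real.pi ^ 2 / 8) by field_simp; norm_num]
  convert! hasSum_one_div_odd_sq.mul_left _ using 2 with k
  field_simp

/-- For the symmetric star with `p` branches and constant diffusion parameter `Θ̂ > 0`,
with decay exponents `μ_{2k} = (2kπ)²·Θ̂/4` (`k ≥ 1`) and `μ_{2k+1} = ((2k+1)π)²·Θ̂/4`
(`k ≥ 0`, multiplicity `p − 1`), the sum of reciprocals equals `(3p − 2)/(6Θ̂)` and the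
robustness `H = √((1/2)·sum)` equals `(1/2)·√((3p − 2)/(3Θ̂))`. -/
theorem stmt_14 (Θ : ℝ) (hΘ : 0 < Θ) (p : ℕ) (hp : 1 ≤ p) :
    (Summable fun k : ℕ => 1 / ((2 * ((k : ℝ) + 1) * Real.pi) ^ 2 * Θ / 4)) ∧
    (Summable fun k : ℕ => 1 / (((2 * (k : ℝ) + 1) * Real.pi) ^ 2 * Θ / 4)) ∧
    (∑' k : ℕ, 1 / ((2 * ((k : ℝ) + 1) * Real.pi) ^ 2 * Θ / 4))
        + ((p : ℝ) - 1) * (∑' k : ℕ, 1 / (((2 * (k : ℝ) + 1) * Real.pi) ^ 2 * Θ / 4))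
      = (3 * (p : ℝ) - 2) / (6 * Θ) ∧
    Real.sqrt ((1 / 2) *
        ((∑' k : ℕ, 1 / ((2 * ((k : ℝ) + 1) * Real.pi) ^ 2 * Θ / 4))
          + ((p : ℝ) - 1) * (∑' k : ℕ, 1 / (((2 * (k : ℝ) + 1) * Real.pi) ^ 2 * Θ / 4))))
      = (1 / 2) * Real.sqrt ((3 * (p : ℝ) - 2) / (3 * Θ)) := by
  have heven := hasSum_inv_even_decay_exponent hΘ
  have hodd := hasSum_inv_odd_decay_exponent hΘ
  have hsum : 1 / (6 * Θ) + ((p : ℝ) - 1) * (1 / (2 * Θ)) = (3 * (p : ℝ) - 2) / (6 * Θ) := by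
    field_simp
    ring
  refine ⟨heven.summable, hodd.summable, ?_, ?_⟩ <;> rw [heven.tsum_eq, hodd.tsum_eq, hsum]
  have hsq : 1 / 2 * ((3 * (p : ℝ) - 2) / (6 * Θ))
      = (1 / 2) ^ 2 * ((3 * (p : ℝ) - 2) / (3 * Θ)) := by
    field_simp
    ring
  rw [hsq, Real.sqrt_mul (by positivity), Real.sqrt_sq (by norm_num)]
end

section
/- Let Θ̂ > 0 and let p be a natural number with p ≥ 1. With μ_{2k} = (3Θ̂/2)·2k·(2k+1) for k ≥ 1 and μ_{2k+1} = (3Θ̂/2)·2(k+1)·(2k+1) for k ≥ 0, the sum of reciprocals of the decay exponents counted with multiplicity satisfies ∑_{k=1}^{∞} 1/μ_{2k} + (p−1)·∑_{k=0}^{∞} 1/μ_{2k+1} = 2·(1 + (p−2)·ln 2)/(3Θ̂). Consequently the robustness H = √( (1/2)·(that sum) ) equals √((1 + (p−2)·ln 2)/(3Θ̂)). -/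
open Filter Topology in
/-- The alternating harmonic series, with consecutive terms grouped in pairs, sums to `log 2`. -/
theorem hasSum_one_div_even_mul_odd_log_two :
    HasSum (fun k : ℕ => 1 / ((2 * ((k : ℝ) + 1)) * (2 * (k : ℝ) + 1))) (Real.log 2) := by
  rw [hasSum_iff_tendsto_nat_of_nonneg (fun k => by positivity)]
  have hpartial (n : ℕ) : ∑ k ∈ Finset.range n, 1 / ((2 * ((k : ℝ) + 1)) * (2 * (k : ℝ) + 1)) =
      (harmonic (2 * n) : ℝ) - harmonic n := by
    induction n with
    | zero => simp
    | succ n ih =>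
      rw [Finset.sum_range_succ, ih, show 2 * (n + 1) = 2 * n + 1 + 1 by ring, harmonic_succ,
        harmonic_succ, harmonic_succ]
      push_cast
      field_simp
      ring
  have hlim := Real.tendsto_harmonic_sub_log
  have hdouble := hlim.comp (tendsto_id.const_mul_atTop' (r := 2) two_pos)
  have hdiff := (hdouble.sub hlim).add_const (Real.log 2)
  rw [sub_self, zero_add] at hdiff
  refine hdiff.congr' ?_
  filter_upwards [eventually_gt_atTop 0] with n hn
  have hn' : (n : ℝ) ≠ 0 := by positivity
  rw [hpartial]
  simp only [Function.comp_apply, id_eq, Nat.cast_mul, Nat.cast_ofNat]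
  rw [Real.log_mul two_ne_zero hn']
  ring

open Filter Topology in
theorem hasSum_one_div_odd_sub_one_div_odd :
    HasSum (fun k : ℕ => 1 / (2 * (k : ℝ) + 1) - 1 / (2 * ((k : ℝ) + 1) + 1)) 1 := by
  rw [hasSum_iff_tendsto_nat_of_nonneg
    (fun k => sub_nonneg.2 (one_div_le_one_div_of_le (by positivity) (by linarith)))]
  have hpartial (n : ℕ) :
      ∑ k ∈ Finset.range n, (1 / (2 * (k : ℝ) + 1) - 1 / (2 * ((k : ℝ) + 1) + 1)) =
        1 - 1 / (2 * (n : ℝ) + 1) := by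
    simpa using Finset.sum_range_sub' (fun k : ℕ => 1 / (2 * (k : ℝ) + 1)) n
  simp only [hpartial]
  have hatTop : Tendsto (fun n : ℕ => 2 * (n : ℝ) + 1) atTop atTop :=
    tendsto_atTop_add_const_right _ _ (tendsto_natCast_atTop_atTop.const_mul_atTop two_pos)
  simpa using hatTop.inv_tendsto_atTop.const_sub (1 : ℝ)

theorem hasSum_one_div_even_mul_succ :
    HasSum (fun k : ℕ => 1 / ((2 * ((k : ℝ) + 1)) * (2 * ((k : ℝ) + 1) + 1)))
      (1 - Real.log 2) := by
  refine (hasSum_one_div_odd_sub_one_div_odd.sub hasSum_one_div_even_mul_odd_log_two).congr_fun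
    fun k => ?_
  field_simp
  ring

/-- For the symmetric star with `p` branches and variable diffusion parameter, with decay
exponents `μ_{2k} = (3Θ̂/2)·2k·(2k+1)` (`k ≥ 1`) and `μ_{2k+1} = (3Θ̂/2)·2(k+1)·(2k+1)`
(`k ≥ 0`, multiplicity `p − 1`), the sum of reciprocals equals `2·(1 + (p−2)·ln 2)/(3Θ̂)`
and the robustness `H = √((1/2)·sum)` equals `√((1 + (p−2)·ln 2)/(3Θ̂))`. -/
theorem stmt_15 (Θ : ℝ) (hΘ : 0 < Θ) (p : ℕ) (hp : 1 ≤ p) :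
    (Summable fun k : ℕ =>
      1 / ((3 * Θ / 2) * (2 * ((k : ℝ) + 1)) * (2 * ((k : ℝ) + 1) + 1))) ∧
    (Summable fun k : ℕ =>
      1 / ((3 * Θ / 2) * (2 * ((k : ℝ) + 1)) * (2 * (k : ℝ) + 1))) ∧
    (∑' k : ℕ, 1 / ((3 * Θ / 2) * (2 * ((k : ℝ) + 1)) * (2 * ((k : ℝ) + 1) + 1)))
        + ((p : ℝ) - 1) *
          (∑' k : ℕ, 1 / ((3 * Θ / 2) * (2 * ((k : ℝ) + 1)) * (2 * (k : ℝ) + 1)))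
      = 2 * (1 + ((p : ℝ) - 2) * Real.log 2) / (3 * Θ) ∧
    Real.sqrt ((1 / 2) *
        ((∑' k : ℕ, 1 / ((3 * Θ / 2) * (2 * ((k : ℝ) + 1)) * (2 * ((k : ℝ) + 1) + 1)))
          + ((p : ℝ) - 1) *
            (∑' k : ℕ, 1 / ((3 * Θ / 2) * (2 * ((k : ℝ) + 1)) * (2 * (k : ℝ) + 1)))))
      = Real.sqrt ((1 + ((p : ℝ) - 2) * Real.log 2) / (3 * Θ)) := by
  have heven := hasSum_one_div_even_mul_succ.mul_left (1 / (3 * Θ / 2))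
  have hodd := hasSum_one_div_even_mul_odd_log_two.mul_left (1 / (3 * Θ / 2))
  simp only [one_div_mul_one_div, ← mul_assoc (3 * Θ / 2) (2 * _)] at heven hodd
  rw [heven.tsum_eq, hodd.tsum_eq]
  refine ⟨heven.summable, hodd.summable, ?_, congrArg Real.sqrt ?_⟩ <;>
  · field_simp
    ring
end
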